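/- Let r ≥ 3 and 2 ≤ k ≤ r, set t = ⌈(r−1)(k−1)/ln(2r)⌉, and suppose t divides n with n > r. Then ex_↻(n, P_k^r) ≥ (t/(2r)) · C(n−1, r−1). -/

import Mathlib

/-- `CycChain ℓ w` says that starting at `w 0` and moving clockwise around the cyclically
ordered set `Fin n` (clockwise = increasing residues), one encounters
`w 1, w 2, ..., w (ℓ-1)` in this order, i.e. `w 0 < w 1 < ... < w (ℓ-1) (< w 0)`
in the cyclic order. -/
def CycChain {n : ℕ} (ℓ : ℕ) (w : ℕ → Fin n) : Prop :=
  ∀ i j : ℕ, i < j → j < ℓ → w i - w 0 < w j - w 0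

/-- `IsCycCrossPath r k H v` says that `v 0, v 1, ..., v (k+r-2)` are distinct vertices forming
an `r`-uniform crossing `k`-path in the convex geometric `r`-graph `H` on the cyclically ordered
vertex set `Fin n`: the edges are `{v i, ..., v (i+r-1)}` for `0 ≤ i ≤ k-1`, and in the cyclic
order:
(i) `v 0 < v 1 < ... < v (r-1)`;
(ii) for each `j < r-1`, `v j < v (j+r) < v (j+2r) < ... < v (j+1)`, the chain running over all
indices `j + i*r ≤ k+r-2`;
(iii) `v 0 < v (r-1) < v (2r-1) < ... < v (⌊(r+k-2)/r⌋*r - 1)`. -/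
def IsCycCrossPath (r k : ℕ) {n : ℕ} (H : Finset (Finset (Fin n))) (v : ℕ → Fin n) : Prop :=
  (∀ i j : ℕ, i < k + r - 1 → j < k + r - 1 → v i = v j → i = j) ∧
  (∀ i : ℕ, i < k → Finset.image v (Finset.Ico i (i + r)) ∈ H) ∧
  CycChain r v ∧
  (∀ j : ℕ, j + 1 < r →
    CycChain ((k + r - 2 - j) / r + 2)
      (fun i => if i = 0 then v j
                else if i ≤ (k + r - 2 - j) / r then v (j + i * r) else v (j + 1))) ∧
  CycChain ((k + r - 2) / r + 1) (fun i => if i = 0 then v 0 else v (i * r - 1))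

/-- `exCycP n r k` is the maximum number of edges in an `n`-vertex convex geometric `r`-graph
containing no crossing `k`-path `P_k^r`. -/
noncomputable def exCycP (n r k : ℕ) : ℕ :=
  sSup {m | ∃ H : Finset (Finset (Fin n)),
    (∀ e ∈ H, e.card = r) ∧ (¬ ∃ v : ℕ → Fin n, IsCycCrossPath r k H v) ∧ H.card = m}

open Finset

/-- Some vertex `v 0` of the `r`-set `e` is such that each of the first `k - 1` gaps of `e`,
read clockwise from `v 0`, is longer than `h`. -/
def HasLongGaps (r k h : ℕ) {n : ℕ} (e : Finset (Fin n)) : Prop :=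
  ∃ v : ℕ → Fin n, e = image v (range r) ∧ CycChain r v ∧
    ∀ i, i + 1 < k → (v i - v 0).val + h < (v (i + 1) - v 0).val

theorem Fin.val_sub_eq_of_le {n : ℕ} {a b : Fin n} (c : Fin n) (h : b - c ≤ a - c) :
    (a - b).val = (a - c).val - (b - c).val := by
  obtain ⟨m, rfl⟩ := Nat.exists_eq_succ_of_ne_zero (Nat.pos_iff_ne_zero.mp a.pos)
  rw [← Fin.sub_val_of_le h, sub_sub_sub_cancel_right]

theorem Fin.val_sub_eq_of_lt {n : ℕ} {a b : Fin n} (c : Fin n) (h : a - c < b - c) :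
    (a - b).val = n + (a - c).val - (b - c).val := by
  obtain ⟨m, rfl⟩ := Nat.exists_eq_succ_of_ne_zero (Nat.pos_iff_ne_zero.mp a.pos)
  rw [← Fin.coe_sub_iff_lt.mpr h, sub_sub_sub_cancel_right]

theorem exists_compression {s q h N : ℕ} {x : ℕ → ℕ} (hqs : q ≤ s) (hx0 : x 0 = 0)
    (hxN : ∀ i ≤ s, x i ≤ N) (hx : ∀ i < s, x i < x (i + 1))
    (hgap : ∀ i < q, x i + h < x (i + 1)) :
    ∃ w : ℕ → ℕ, (∀ i < s, x (i + 1) = w i + 1 + h * min (i + 1) q) ∧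
      (∀ i j, i < j → j < s → w i < w j) ∧ ∀ i < s, w i < N - q * h := by
  have hlow : ∀ i < s, 1 + h * min (i + 1) q ≤ x (i + 1) := by
    intro i
    induction i with
    | zero =>
      intro hi
      have h1 := hx 0 hi
      rcases Nat.eq_zero_or_pos q with rfl | hq
      · simp only [zero_add, Nat.min_zero, mul_zero, add_zero] at *
        omega
      · have := hgap 0 hq
        rw [min_eq_left (by omega)]
        simp only [zero_add, mul_one] at *
        omega
    | succ i ih =>
      intro hi
      have h1 := ih (by omega)
      have h2 := hx (i + 1) hi
      rcases lt_or_ge (i + 1) q with hq | hq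
      · have := hgap (i + 1) hq
        rw [min_eq_left (by omega)] at h1 ⊢
        linarith [mul_add h (i + 1) 1]
      · rw [min_eq_right (by omega)] at h1 ⊢
        omega
  have hstep : ∀ i, i + 1 < s → x (i + 1) - (1 + h * min (i + 1) q) <
      x (i + 2) - (1 + h * min (i + 2) q) := by
    intro i hi
    have h1 := hlow i (by omega)
    have h2 := hx (i + 1) hi
    rcases lt_or_ge (i + 1) q with hq | hq
    · have h3 := hgap (i + 1) hq
      rw [min_eq_left (by omega)] at h1 ⊢
      rw [min_eq_left (by omega)]
      have := mul_add h (i + 1) 1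
      rw [show i + 1 + 1 = i + 2 from rfl] at *
      omega
    · rw [min_eq_right (by omega)] at h1 ⊢
      rw [min_eq_right (by omega)]
      rw [show i + 1 + 1 = i + 2 from rfl] at *
      omega
  have hmono : ∀ j i, i < j → j < s → x (i + 1) - (1 + h * min (i + 1) q) <
      x (j + 1) - (1 + h * min (j + 1) q) := by
    intro j
    induction j with
    | zero => intro i hi; omega
    | succ j ih =>
      intro i hi hj
      rcases Nat.lt_succ_iff_lt_or_eq.mp hi with hi' | rfl
      · exact (ih i hi' (by omega)).trans (hstep j hj)
      · exact hstep i hj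
  refine ⟨fun i => x (i + 1) - (1 + h * min (i + 1) q), ?_, fun i j hij hj => hmono j i hij hj, ?_⟩
  · intro i hi
    have := hlow i hi
    dsimp only
    omega
  · intro i hi
    have hlast : x (s - 1 + 1) - (1 + h * min (s - 1 + 1) q) < N - q * h := by
      have h1 := hlow (s - 1) (by omega)
      have h2 := hxN s le_rfl
      rw [show s - 1 + 1 = s by omega, min_eq_right hqs] at h1 ⊢
      rw [mul_comm q h]
      omega
    rcases Nat.lt_or_ge i (s - 1) with hi' | hi'
    · exact (hmono (s - 1) i hi' (by omega)).trans hlast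
    · obtain rfl : i = s - 1 := by omega
      exact hlast

open Classical in
theorem card_hasLongGaps_le (s k h N : ℕ) (hk : 1 ≤ k) (hks : k ≤ s + 1) :
    #{e : Finset (Fin (N + 1)) | HasLongGaps (s + 1) k h e} ≤
      (N + 1) * (N - (k - 1) * h).choose s := by
  let F : Fin (N + 1) × Finset ℕ → Finset (Fin (N + 1)) := fun p =>
    insert p.1 (p.2.image fun w =>
      p.1 + Fin.ofNat (N + 1) (w + 1 + h * min (#{y ∈ p.2 | y < w} + 1) (k - 1)))
  have hsub : ({e : Finset (Fin (N + 1)) | HasLongGaps (s + 1) k h e} : Finset _) ⊆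
      ((univ : Finset (Fin (N + 1))) ×ˢ powersetCard s (range (N - (k - 1) * h))).image F := by
    intro e he
    obtain ⟨v, rfl, hv, hgap⟩ := (mem_filter.mp he).2
    obtain ⟨w, hw, hmono, hlt⟩ := exists_compression (s := s) (q := k - 1) (h := h) (N := N)
      (x := fun i => (v i - v 0).val) (by omega) (by simp)
      (fun i _ => Nat.lt_succ_iff.mp (v i - v 0).isLt)
      (fun i hi => hv i (i + 1) (by omega) (by omega)) (fun i hi => hgap i (by omega))
    have hinj : Set.InjOn w (range s) := by
      intro i hi j hj hij
      rcases lt_trichotomy i j with hl | hl | hl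
      · exact absurd hij (hmono i j hl (by simpa using hj)).ne
      · exact hl
      · exact absurd hij (hmono j i hl (by simpa using hi)).ne'
    have hrank : ∀ i < s, #{y ∈ image w (range s) | y < w i} = i := by
      intro i hi
      have : {y ∈ image w (range s) | y < w i} = image w (range i) := by
        ext y
        simp only [mem_filter, mem_image, mem_range]
        constructor
        · rintro ⟨⟨j, hj, rfl⟩, hji⟩
          refine ⟨j, ?_, rfl⟩
          by_contra! hcon
          rcases hcon.eq_or_lt with rfl | hl
          · exact lt_irrefl _ hji
          · exact lt_asymm hji (hmono i j hl hj)
        · rintro ⟨j, hj, rfl⟩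
          exact ⟨⟨j, hj.trans hi, rfl⟩, hmono j i hj hi⟩
      rw [this, card_image_of_injOn (hinj.mono (by simpa using hi.le)), card_range]
    refine mem_image.mpr ⟨(v 0, image w (range s)), ?_, ?_⟩
    · refine mem_product.mpr ⟨mem_univ _, mem_powersetCard.mpr ⟨?_, ?_⟩⟩
      · intro y hy
        obtain ⟨i, hi, rfl⟩ := mem_image.mp hy
        exact mem_range.mpr (hlt i (mem_range.mp hi))
      · rw [card_image_of_injOn hinj, card_range]
    · simp only [F]
      have hr : range (s + 1) = insert 0 ((range s).image (· + 1)) := by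
        ext i
        simp only [mem_range, mem_insert, mem_image]
        constructor
        · intro hi
          rcases Nat.eq_zero_or_pos i with rfl | hi0
          · exact Or.inl rfl
          · exact Or.inr ⟨i - 1, by omega, by omega⟩
        · rintro (rfl | ⟨j, hj, rfl⟩) <;> omega
      rw [hr, image_insert, image_image, image_image]
      congr 1
      refine image_congr fun i hi => ?_
      have hi' : i < s := by simpa using hi
      simp only [Function.comp_apply]
      rw [hrank i hi', ← hw i hi', Fin.ofNat_val_eq_self, add_sub_cancel]
  refine (card_le_card hsub).trans (card_image_le.trans ?_)
  rw [card_product, card_powersetCard, card_range, card_univ, Fintype.card_fin]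

theorem choose_sub_mul_le (N d s : ℕ) (hs : 1 ≤ s)
    (hd : Real.log (2 * ((s : ℝ) + 1)) * ((N : ℝ) - ((s : ℝ) - 1) / 2 - (d : ℝ) / 2) ≤ s * d) :
    ((N - d).choose s : ℝ) * (2 * ((s : ℝ) + 1)) ≤ (N.choose s : ℝ) := by
  by_cases hlt : N - d < s
  · rw [Nat.choose_eq_zero_of_lt hlt]; simp
  have hN : d + s ≤ N := by omega
  have hNr : (d : ℝ) + s ≤ N := by exact_mod_cast hN
  have hs' : (1 : ℝ) ≤ s := by exact_mod_cast hs
  have hd0 : (0 : ℝ) ≤ d := Nat.cast_nonneg d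
  set M : ℝ := (N : ℝ) - ((s : ℝ) - 1) / 2 - (d : ℝ) / 2 with hM
  have hMpos : 0 < M := by rw [hM]; linarith
  have hfac : ∀ i ∈ range s, (((N - d - i : ℕ)) : ℝ) ≤
      ((N - i : ℕ) : ℝ) * Real.exp (-(d / ((N : ℝ) - i - d / 2))) := by
    intro i hi
    have hi' : i + 1 ≤ s := mem_range.mp hi
    have hir : (i : ℝ) + 1 ≤ s := by exact_mod_cast hi'
    rw [Nat.cast_sub (by omega), Nat.cast_sub (by omega), Nat.cast_sub (by omega)]
    have hy : (0 : ℝ) < N - d - i := by linarith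
    have h1 := Real.le_log_one_add_of_nonneg (x := (d : ℝ) / (N - d - i)) (by positivity)
    have e1 : 2 * ((d : ℝ) / (N - d - i)) / ((d : ℝ) / (N - d - i) + 2) =
        d / ((N : ℝ) - i - d / 2) := by
      have hz : (N : ℝ) - i - d / 2 = (N - d - i) + d / 2 := by ring
      rw [hz]
      generalize (N : ℝ) - d - i = y at hy
      have : y + d / 2 ≠ 0 := by positivity
      have : (d : ℝ) + y * 2 ≠ 0 := by positivity
      field_simp
      ring
    have e2 : 1 + (d : ℝ) / (N - d - i) = (N - i) / (N - d - i) := by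
      field_simp; ring
    rw [e1, e2] at h1
    have hp : (0 : ℝ) < (N - i) / (N - d - i) := div_pos (by linarith) hy
    have h2 := (Real.le_log_iff_exp_le hp).mp h1
    rw [Real.exp_neg, ← div_eq_mul_inv, le_div_iff₀ (Real.exp_pos _)]
    calc _ ≤ (N - d - i : ℝ) * ((N - i) / (N - d - i)) := by gcongr
      _ = _ := by field_simp
  have hprod := prod_le_prod (fun i _ => Nat.cast_nonneg _) hfac
  rw [prod_mul_distrib, ← Real.exp_sum, ← Nat.cast_prod, ← Nat.cast_prod,
    ← Nat.descFactorial_eq_prod_range, ← Nat.descFactorial_eq_prod_range,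
    Nat.descFactorial_eq_factorial_mul_choose, Nat.descFactorial_eq_factorial_mul_choose] at hprod
  have hsum : s * d / M ≤ ∑ i ∈ range s, d / ((N : ℝ) - i - d / 2) := by
    have htan : ∀ i ∈ range s, (d : ℝ) * (2 / M - (N - i - d / 2) / M ^ 2) ≤
        d / ((N : ℝ) - i - d / 2) := by
      intro i hi
      have hi' : i + 1 ≤ s := mem_range.mp hi
      have hir : (i : ℝ) + 1 ≤ s := by exact_mod_cast hi'
      have hy : (0 : ℝ) < N - i - d / 2 := by linarith
      rw [div_eq_mul_inv (d : ℝ) ((N : ℝ) - i - d / 2)]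
      refine mul_le_mul_of_nonneg_left ?_ hd0
      rw [← one_div, le_div_iff₀ hy, ← sub_nonneg]
      have : 1 - (2 / M - ((N : ℝ) - i - d / 2) / M ^ 2) * (N - i - d / 2) =
        (1 - ((N : ℝ) - i - d / 2) / M) ^ 2 := by field_simp; ring
      rw [this]; positivity
    refine le_trans (le_of_eq ?_) (sum_le_sum htan)
    have hg : ∑ i ∈ range s, (i : ℝ) = s * (s - 1) / 2 := by
      have := Finset.sum_range_id_mul_two s
      have h2 : ((∑ i ∈ range s, i : ℕ) : ℝ) * 2 = s * (s - 1) := by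
        rw [← Nat.cast_two, ← Nat.cast_mul, this]; push_cast [Nat.cast_sub hs]; ring
      push_cast at h2
      linarith
    have hy : ∑ i ∈ range s, ((N : ℝ) - i - d / 2) = s * M := by
      simp only [sum_sub_distrib, sum_const, card_range, nsmul_eq_mul, hg]
      rw [hM]; ring
    rw [← mul_sum, sum_sub_distrib, ← sum_div (range s) (fun i => (N : ℝ) - i - d / 2), hy]
    simp only [sum_const, card_range, nsmul_eq_mul]
    field_simp
    ring
  have hexp : Real.exp (∑ i ∈ range s, -(d / ((N : ℝ) - i - d / 2))) ≤ (2 * ((s : ℝ) + 1))⁻¹ := by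
    rw [sum_neg_distrib, Real.exp_neg]
    refine inv_anti₀ (by positivity) ?_
    rw [← Real.log_le_iff_le_exp (by positivity)]
    refine le_trans ?_ hsum
    rwa [le_div_iff₀ hMpos]
  push_cast at hprod
  have hf : (0 : ℝ) < s.factorial := by exact_mod_cast s.factorial_pos
  rw [mul_assoc] at hprod
  have h4 := le_of_mul_le_mul_left hprod hf
  have h5 := h4.trans (mul_le_mul_of_nonneg_left hexp (Nat.cast_nonneg _))
  rwa [← div_eq_mul_inv, le_div_iff₀ (by positivity)] at h5

open Classical in
/-- The `r`-sets whose vertex sum differs from `c` by a multiple `j * h`, `j < T`, and that have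
no `k - 1` consecutive long gaps, where for `b = 1` long gaps are allowed if the sum is `c`. -/
noncomputable def spacedFamily (r k h T b : ℕ) {N : ℕ} (c : Fin (N + 1)) :
    Finset (Finset (Fin (N + 1))) :=
  {e ∈ powersetCard r univ | (∃ j < T, (∑ x ∈ e, x - c).val = j * h) ∧
    (HasLongGaps r k h e → b = 1 ∧ ∑ x ∈ e, x = c)}

theorem le_val_sub_of_multiples {N T h i j : ℕ} {a c : Fin (N + 1)} (hT : T * h ≤ N + 1)
    (hj : j < T) (ha : a.val = i * h) (hc : c.val = j * h) (hac : a ≠ c) :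
    h ≤ (a - c).val := by
  rcases lt_trichotomy i j with hij | rfl | hij
  · have hlt : a < c := by
      rw [Fin.lt_def]
      refine lt_of_le_of_ne ?_ (fun hv => hac (Fin.ext hv))
      rw [ha, hc]
      exact Nat.mul_le_mul_right h hij.le
    rw [Fin.coe_sub_iff_lt.mpr hlt, ha, hc]
    have : (j + 1) * h ≤ T * h := Nat.mul_le_mul_right h hj
    rw [add_mul, one_mul] at this
    omega
  · exact absurd (Fin.ext (ha.trans hc.symm)) hac
  · have hle : c ≤ a := by
      rw [Fin.le_def, ha, hc]
      exact Nat.mul_le_mul_right h hij.le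
    rw [Fin.sub_val_of_le hle, ha, hc]
    have : (j + 1) * h ≤ i * h := Nat.mul_le_mul_right h hij
    rw [add_mul, one_mul] at this
    omega

theorem IsCycCrossPath.lt_of_add_one_lt {r k n : ℕ} {H : Finset (Finset (Fin n))} {v : ℕ → Fin n}
    (hv : IsCycCrossPath r k H v) (hkr : k ≤ r) {i : ℕ} (hi : i + 1 < k) :
    v (i + r) - v i < v (i + 1) - v i := by
  have hdiv : (k + r - 2 - i) / r = 1 :=
    Nat.div_eq_of_lt_le (by omega) (by omega)
  have := hv.2.2.2.1 i (by omega) 1 2 (by omega) (by omega)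
  simpa [hdiv] using this

theorem IsCycCrossPath.sum_sub_sum {r k N : ℕ} {H : Finset (Finset (Fin (N + 1)))}
    {v : ℕ → Fin (N + 1)} (hv : IsCycCrossPath r k H v) {i : ℕ} (hi : i + 1 < k) (hr : 1 ≤ r) :
    ∑ x ∈ image v (Ico (i + 1) (i + 1 + r)), x - ∑ x ∈ image v (Ico i (i + r)), x =
      v (i + r) - v i := by
  have hinj : ∀ j, j < k → Set.InjOn v (Ico j (j + r)) := by
    intro j hj a ha b hb hab
    simp only [coe_Ico, Set.mem_Ico] at ha hb
    exact hv.1 a b (by omega) (by omega) hab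
  rw [sum_image (hinj _ hi), sum_image (hinj _ (by omega)),
    sum_eq_sum_Ico_succ_bot (by omega : i < i + r), show i + 1 + r = i + r + 1 by omega,
    sum_Ico_succ_top (by omega : i + 1 ≤ i + r)]
  abel

open Classical in
theorem not_isCycCrossPath_spacedFamily {r k h T b N : ℕ} (hr : 3 ≤ r) (hk : 2 ≤ k) (hkr : k ≤ r)
    (hT : T * h ≤ N + 1) (hb : b = 1 → k = 2) (c : Fin (N + 1)) :
    ¬ ∃ v : ℕ → Fin (N + 1), IsCycCrossPath r k (spacedFamily r k h T b c) v := by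
  rintro ⟨v, hv⟩
  have hedge : ∀ i < k, (∃ j < T, (∑ x ∈ image v (Ico i (i + r)), x - c).val = j * h) ∧
      (HasLongGaps r k h (image v (Ico i (i + r))) →
        b = 1 ∧ ∑ x ∈ image v (Ico i (i + r)), x = c) :=
    fun i hi => (mem_filter.mp (hv.2.1 i hi)).2
  have hchain := hv.2.2.1
  have hne : ∀ i, i + 1 < k → v (i + r) - v i ≠ 0 := by
    intro i hi h0
    have := hv.1 _ _ (by omega) (by omega) (sub_eq_zero.mp h0)
    omega
  have hjump : ∀ i, i + 1 < k → h ≤ (v (i + r) - v i).val := by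
    intro i hi
    obtain ⟨j, hj, hij⟩ := (hedge i (by omega)).1
    obtain ⟨j', hj', hij'⟩ := (hedge (i + 1) hi).1
    have hs := hv.sum_sub_sum hi (by omega)
    rw [← hs, ← sub_sub_sub_cancel_right _ _ c]
    refine le_val_sub_of_multiples hT hj hij' hij fun heq => hne i hi ?_
    rw [← hs, sub_left_inj.mp heq, sub_self]
  have hgap : ∀ i, i + 1 < k → (v i - v 0).val + h < (v (i + 1) - v 0).val := by
    intro i hi
    have h1 := hjump i hi
    have h2 := Fin.lt_def.mp (hv.lt_of_add_one_lt hkr hi)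
    have hle : v i - v 0 ≤ v (i + 1) - v 0 := by
      rcases Nat.eq_zero_or_pos i with rfl | hi0
      · simp
      · exact (hchain i (i + 1) (by omega) (by omega)).le
    rw [Fin.val_sub_eq_of_le (v 0) hle] at h2
    omega
  obtain ⟨hb1, hc⟩ := (hedge 0 (by omega)).2 ⟨v, by rw [zero_add, range_eq_Ico], hchain, hgap⟩
  obtain rfl := hb hb1
  have hlast : ∀ a, v a - v 0 < v (r - 1) - v 0 →
      (v a - v (r - 1)).val = N + 1 + (v a - v 0).val - (v (r - 1) - v 0).val :=
    fun a ha => Fin.val_sub_eq_of_lt (v 0) ha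
  have hr0 : v r - v 0 < v 1 - v 0 := by simpa using hv.lt_of_add_one_lt hkr one_lt_two
  have hr1 : v r - v 0 < v (r - 1) - v 0 := hr0.trans (hchain 1 (r - 1) (by omega) (by omega))
  have hbound := (v (r - 1) - v 0).isLt
  have hlong : HasLongGaps r 2 h (image v (Ico (0 + 1) (0 + 1 + r))) := by
    let u : ℕ → Fin (N + 1) := fun i => if i = 0 then v (r - 1) else if i = 1 then v r else v (i - 1)
    refine ⟨u, ?_, ?_, ?_⟩
    · ext y
      simp only [mem_image, mem_Ico, mem_range, u]
      constructor
      · rintro ⟨i, hi, rfl⟩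
        rcases (by omega : i = r - 1 ∨ i = r ∨ (1 ≤ i ∧ i + 1 < r)) with rfl | rfl | hi'
        · exact ⟨0, by omega, by simp⟩
        · exact ⟨1, by omega, by simp⟩
        · exact ⟨i + 1, by omega, by simp [show i ≠ 0 by omega]⟩
      · rintro ⟨i, hi, rfl⟩
        split_ifs with h0 h1
        · exact ⟨r - 1, by omega, rfl⟩
        · exact ⟨r, by omega, rfl⟩
        · exact ⟨i - 1, by omega, rfl⟩
    · intro i j hij hj
      have hu : ∀ a, 2 ≤ a → a < r →
          (u a - u 0).val = N + 1 + (v (a - 1) - v 0).val - (v (r - 1) - v 0).val := by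
        intro a ha har
        simp only [u, show a ≠ 0 by omega, show a ≠ 1 by omega, if_false, if_true]
        exact hlast _ (hchain _ _ (by omega) (by omega))
      have hu1 : (u 1 - u 0).val = N + 1 + (v r - v 0).val - (v (r - 1) - v 0).val := hlast r hr1
      rw [Fin.lt_def]
      rcases (by omega : i = 0 ∨ i = 1 ∨ 2 ≤ i) with rfl | rfl | hi
      · rw [sub_self, Fin.val_zero]
        rcases (by omega : j = 1 ∨ 2 ≤ j) with rfl | hj2
        · omega
        · rw [hu j hj2 hj]
          omega
      · rw [hu1, hu j (by omega) hj]
        have h3 : v 1 - v 0 ≤ v (j - 1) - v 0 := by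
          rcases (by omega : j = 2 ∨ 2 < j) with rfl | hj2
          · exact le_rfl
          · exact (hchain 1 (j - 1) (by omega) (by omega)).le
        have h4 := Fin.lt_def.mp (hr0.trans_le h3)
        omega
      · rw [hu i hi (by omega), hu j (by omega) hj]
        have h4 := Fin.lt_def.mp (hchain (i - 1) (j - 1) (by omega) (by omega))
        omega
    · intro i hi
      obtain rfl : i = 0 := by omega
      have h1 := hjump 0 (by omega)
      rw [zero_add] at h1
      have h2 : (u (0 + 1) - u 0).val = N + 1 + (v r - v 0).val - (v (r - 1) - v 0).val :=
        hlast r hr1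
      rw [h2, sub_self, Fin.val_zero]
      omega
  obtain ⟨-, hc'⟩ := (hedge (0 + 1) (by omega)).2 hlong
  refine hne 0 (by omega) ?_
  rw [← hv.sum_sub_sum (by omega) (by omega), hc, hc', sub_self]

open Classical in
theorem exists_le_card_spacedFamily {r k h T b N : ℕ} (hh : 1 ≤ h) (hT : T * h ≤ N + 1)
    (hT1 : 1 ≤ T) (hb : b ≤ 1) :
    ∃ c : Fin (N + 1), T * (N + 1).choose r ≤ (N + 1) * #(spacedFamily r k h T b c) +
      (T - b) * #{e : Finset (Fin (N + 1)) | HasLongGaps r k h e} := by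
  let rel : Finset (Fin (N + 1)) → Fin (N + 1) → Prop := fun e c =>
    (∃ j < T, (∑ x ∈ e, x - c).val = j * h) ∧ (HasLongGaps r k h e → b = 1 ∧ ∑ x ∈ e, x = c)
  have hlow : ∀ e, T ≤ #{c | rel e c} + if HasLongGaps r k h e then T - b else 0 := by
    intro e
    split_ifs with he
    · suffices b ≤ #{c | rel e c} by omega
      rcases (by omega : b = 0 ∨ b = 1) with rfl | rfl
      · exact Nat.zero_le _
      · refine card_pos.mpr ⟨∑ x ∈ e, x, mem_filter.mpr ⟨mem_univ _, ⟨0, hT1, by simp⟩, ?_⟩⟩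
        exact fun _ => ⟨rfl, rfl⟩
    · have hlt : ∀ j < T, j * h < N + 1 := fun j hj =>
        (Nat.mul_lt_mul_of_pos_right hj hh).trans_le hT
      have hinj : Set.InjOn (fun j => ∑ x ∈ e, x - Fin.ofNat (N + 1) (j * h)) (range T) := by
        intro i hi j hj hij
        have h1 := congrArg Fin.val (sub_right_injective hij)
        rw [Fin.val_ofNat, Fin.val_ofNat, Nat.mod_eq_of_lt (hlt i (by simpa using hi)),
          Nat.mod_eq_of_lt (hlt j (by simpa using hj))] at h1
        exact Nat.eq_of_mul_eq_mul_right hh h1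
      rw [add_zero]
      conv_lhs => rw [← card_range T, ← card_image_of_injOn hinj]
      refine card_le_card fun c hc => ?_
      obtain ⟨j, hj, rfl⟩ := mem_image.mp hc
      have hj' := mem_range.mp hj
      refine mem_filter.mpr ⟨mem_univ _, ⟨j, hj', ?_⟩, fun h => absurd h he⟩
      rw [sub_sub_cancel, Fin.val_ofNat, Nat.mod_eq_of_lt (hlt j hj')]
  have hsum := sum_le_sum (s := powersetCard r (univ : Finset (Fin (N + 1)))) fun e _ => hlow e
  rw [sum_const, card_powersetCard, card_univ, Fintype.card_fin, sum_add_distrib,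
    smul_eq_mul, mul_comm] at hsum
  have hdouble := sum_card_bipartiteAbove_eq_sum_card_bipartiteBelow rel
    (s := powersetCard r (univ : Finset (Fin (N + 1)))) (t := univ)
  simp only [bipartiteAbove] at hdouble
  rw [hdouble] at hsum
  have hbad : ∑ e ∈ powersetCard r (univ : Finset (Fin (N + 1))),
      (if HasLongGaps r k h e then T - b else 0) ≤
      (T - b) * #{e : Finset (Fin (N + 1)) | HasLongGaps r k h e} := by
    rw [← sum_filter, sum_const, smul_eq_mul, mul_comm]
    exact Nat.mul_le_mul_left _ (card_le_card (filter_subset_filter _ (subset_univ _)))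
  obtain ⟨c, -, hc⟩ := exists_max_image (univ : Finset (Fin (N + 1)))
    (fun c => #(spacedFamily r k h T b c)) univ_nonempty
  refine ⟨c, hsum.trans (add_le_add ?_ hbad)⟩
  have := sum_le_card_nsmul univ (fun c => #(spacedFamily r k h T b c)) _ hc
  rwa [card_univ, Fintype.card_fin, smul_eq_mul] at this

theorem card_le_exCycP {n r k : ℕ} {H : Finset (Finset (Fin n))} (hH : ∀ e ∈ H, #e = r)
    (hpath : ¬ ∃ v : ℕ → Fin n, IsCycCrossPath r k H v) : #H ≤ exCycP n r k := by
  refine le_csSup ⟨Fintype.card (Finset (Fin n)), ?_⟩ ⟨H, hH, hpath, rfl⟩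
  rintro m ⟨H', -, -, rfl⟩
  exact card_le_univ H'

open Classical in
theorem le_exCycP_of_log_le {s k h T b N : ℕ} (hs : 2 ≤ s) (hk : 2 ≤ k) (hks : k ≤ s + 1)
    (hh : 1 ≤ h) (hT : T * h ≤ N + 1) (hT1 : 1 ≤ T) (hb : b = 0 ∨ b = 1 ∧ k = 2)
    (hlog : b < T → Real.log (2 * ((s : ℝ) + 1)) *
      ((N : ℝ) - ((s : ℝ) - 1) / 2 - (((k - 1) * h : ℕ) : ℝ) / 2) ≤ s * ((k - 1) * h : ℕ)) :
    ((T : ℝ) + b) / (2 * ((s : ℝ) + 1)) * (N.choose s : ℝ) ≤ exCycP (N + 1) (s + 1) k := by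
  obtain ⟨c, hc⟩ := exists_le_card_spacedFamily (r := s + 1) (k := k) (b := b) hh hT hT1 (by omega)
  have hex : #(spacedFamily (s + 1) k h T b c) ≤ exCycP (N + 1) (s + 1) k :=
    card_le_exCycP (fun e he => (mem_powersetCard.mp (mem_filter.mp he).1).2)
      (not_isCycCrossPath_spacedFamily (by omega) hk hks hT (by omega) c)
  have hbad := card_hasLongGaps_le s k h N (by omega) hks
  have h1 : T * (N + 1).choose (s + 1) ≤ (N + 1) * exCycP (N + 1) (s + 1) k +
      (T - b) * ((N + 1) * (N - (k - 1) * h).choose s) :=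
    hc.trans (add_le_add (Nat.mul_le_mul_left _ hex) (Nat.mul_le_mul_left _ hbad))
  have h2 : T * N.choose s ≤ (s + 1) * (exCycP (N + 1) (s + 1) k +
      (T - b) * (N - (k - 1) * h).choose s) := by
    refine Nat.le_of_mul_le_mul_left ?_ (Nat.add_one_pos N)
    calc (N + 1) * (T * N.choose s) = T * ((N + 1) * N.choose s) := by ring
      _ = (T * (N + 1).choose (s + 1)) * (s + 1) := by rw [Nat.add_one_mul_choose_eq]; ring
      _ ≤ _ := Nat.mul_le_mul_right _ h1
      _ = _ := by ring
  have hbT : b ≤ T := by omega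
  have h3 : ((T : ℝ) - b) * ((N - (k - 1) * h).choose s * (2 * ((s : ℝ) + 1))) ≤
      (T - b) * N.choose s := by
    rcases hbT.eq_or_lt with rfl | hlt
    · simp
    · exact mul_le_mul_of_nonneg_left (choose_sub_mul_le N _ s (by omega) (hlog hlt))
        (sub_nonneg.mpr (by exact_mod_cast hbT))
  have h4 : (T : ℝ) * N.choose s ≤ (s + 1) * (exCycP (N + 1) (s + 1) k +
      (T - b) * (N - (k - 1) * h).choose s) := by
    have : ((T * N.choose s : ℕ) : ℝ) ≤ _ := Nat.cast_le.mpr h2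
    push_cast [Nat.cast_sub hbT] at this ⊢
    exact this
  rw [div_mul_eq_mul_div, div_le_iff₀ (by positivity)]
  linarith

theorem two_le_log_two_mul {s : ℝ} (hs : 3 ≤ s) : 2 ≤ Real.log (2 * (s + 1)) := by
  rw [Real.le_log_iff_exp_le (by linarith), ← one_add_one_eq_two, Real.exp_add]
  nlinarith [Real.exp_one_lt_d9, Real.exp_pos 1]

theorem one_lt_log_two_mul {s : ℝ} (hs : 2 ≤ s) : 1 < Real.log (2 * (s + 1)) := by
  rw [Real.lt_log_iff_exp_lt (by linarith)]
  linarith [Real.exp_one_lt_d9]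

theorem log_two_mul_lt {s : ℝ} (hs : 2 ≤ s) : Real.log (2 * (s + 1)) < s := by
  rw [Real.log_lt_iff_lt_exp (by linarith)]
  have h1 := Real.add_one_le_exp (s - 2)
  have h2 : Real.exp s = Real.exp 1 * Real.exp 1 * Real.exp (s - 2) := by
    rw [← Real.exp_add, ← Real.exp_add]; ring_nf
  have h3 : 7 < Real.exp 1 * Real.exp 1 := by nlinarith [Real.exp_one_gt_d9]
  have h4 := mul_le_mul h3.le h1 (by linarith) (by positivity)
  linarith

/-- Let `r ≥ 3`, `2 ≤ k ≤ r`, `t = ⌈(r−1)(k−1)/ln(2r)⌉`, and suppose `t`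
divides `n` and `n > r`. Then `ex_↻(n, P_k^r) ≥ (t/(2r))·C(n−1, r−1)`. -/
theorem stmt13 (r k n t : ℕ) (hr : 3 ≤ r) (hk : 2 ≤ k) (hkr : k ≤ r)
    (ht : (t : ℤ) = ⌈((r : ℝ) - 1) * ((k : ℝ) - 1) / Real.log (2 * r)⌉)
    (htn : t ∣ n) (hn : r < n) :
    (t : ℝ) / (2 * (r : ℝ)) * ((n - 1).choose (r - 1) : ℝ) ≤ (exCycP n r k : ℝ) := by
  obtain ⟨s, rfl⟩ : ∃ s, r = s + 1 := ⟨r - 1, by omega⟩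
  obtain ⟨N, rfl⟩ : ∃ N, n = N + 1 := ⟨n - 1, by omega⟩
  obtain ⟨q, rfl⟩ : ∃ q, k = q + 1 := ⟨k - 1, by omega⟩
  have hs : (2 : ℝ) ≤ s := by exact_mod_cast (by omega : 2 ≤ s)
  have hq : (1 : ℝ) ≤ q := by exact_mod_cast (by omega : 1 ≤ q)
  push_cast at ht ⊢
  simp only [add_sub_cancel_right] at ht
  have hL1 := one_lt_log_two_mul hs
  have hLs := log_two_mul_lt hs
  have hL2 : 3 ≤ s → 2 ≤ Real.log (2 * ((s : ℝ) + 1)) := fun h =>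
    two_le_log_two_mul (by exact_mod_cast h)
  set L := Real.log (2 * ((s : ℝ) + 1)) with hL
  have hL0 : 0 < L := by linarith
  have hceil := Int.ceil_eq_iff.mp ht.symm
  push_cast at hceil
  rw [lt_div_iff₀ hL0, div_le_iff₀ hL0] at hceil
  obtain ⟨hlt, hle⟩ := hceil
  have ht1 : 1 ≤ t := by
    by_contra! h0
    obtain rfl : t = 0 := by omega
    push_cast at hle
    nlinarith
  rcases (by omega : 2 ≤ q ∨ q = 1) with hq2 | rfl
  · obtain ⟨h, hth⟩ := htn
    have hh : 1 ≤ h := Nat.pos_of_ne_zero (by rintro rfl; omega)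
    have hq2' : (2 : ℝ) ≤ q := by exact_mod_cast hq2
    have hth' : (N : ℝ) + 1 = t * h := by exact_mod_cast hth
    have := le_exCycP_of_log_le (s := s) (k := q + 1) (h := h) (T := t) (b := 0) (N := N)
      (by omega) hk hkr hh hth.ge ht1 (Or.inl rfl) fun _ => ?_
    · simpa using this
    · rw [Nat.add_sub_cancel, ← hL]
      push_cast
      have hh0 : (0 : ℝ) ≤ h := Nat.cast_nonneg h
      calc L * ((N : ℝ) - (s - 1) / 2 - q * h / 2) ≤ L * (t * h - q * h / 2) := by
            gcongr; linarith
        _ = h * ((t - 1) * L + L - L * q / 2) := by ring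
        _ ≤ h * (s * q) := by gcongr; nlinarith
        _ = s * (q * h) := by ring
  · push_cast at hlt hle
    rw [mul_one] at hlt hle
    have ht2 : 2 ≤ t := by
      by_contra! h0
      obtain rfl : t = 1 := by omega
      push_cast at hle
      linarith
    obtain ⟨T, rfl⟩ : ∃ T, t = T + 1 := ⟨t - 1, by omega⟩
    push_cast at hlt ⊢
    rw [add_sub_cancel_right] at hlt
    have hTs : T < s := by
      have : (T : ℝ) < s := by nlinarith [Nat.cast_nonneg (α := ℝ) T]
      exact_mod_cast this
    have hThalf : 2 * (T : ℝ) ≤ s + 3 := by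
      rcases (by omega : s = 2 ∨ 3 ≤ s) with rfl | h3
      · exact_mod_cast (by omega : 2 * T ≤ 2 + 3)
      · nlinarith [hL2 h3, Nat.cast_nonneg (α := ℝ) T]
    have := le_exCycP_of_log_le (s := s) (k := 1 + 1) (h := (N + 1) / T) (T := T) (b := 1) (N := N)
      (by omega) hk hkr (Nat.div_pos (by omega) (by omega)) (Nat.mul_div_le _ _) (by omega)
      (Or.inr ⟨rfl, rfl⟩) fun _ => ?_
    · simpa using this
    · rw [Nat.add_sub_cancel, one_mul, ← hL]
      have hdiv : N + 2 ≤ T * ((N + 1) / T) + T := by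
        have h1 := Nat.div_add_mod (N + 1) T
        have h2 := Nat.mod_lt (N + 1) (by omega : 0 < T)
        omega
      have hdiv' : (N : ℝ) + 2 ≤ T * ((N + 1) / T : ℕ) + T := by exact_mod_cast hdiv
      have hh0 : (0 : ℝ) ≤ ((N + 1) / T : ℕ) := Nat.cast_nonneg _
      calc L * ((N : ℝ) - (s - 1) / 2 - ((N + 1) / T : ℕ) / 2) ≤ L * (T * ((N + 1) / T : ℕ)) := by
            gcongr; linarith
        _ = T * L * ((N + 1) / T : ℕ) := by ring
        _ ≤ s * ((N + 1) / T : ℕ) := by gcongr
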